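/- Let σ be the K-algebra automorphism of P_n = K[x_1,…,x_n] (n ≥ 2) with σ(x_1) = x_1 − 1 and σ(x_i) = x_i + x_{i−1} for 2 ≤ i ≤ n, and set m = ⌊n/2⌋ and μ = ⌊(n−1)/2⌋. Then the n−1 elements u_1, …, u_m, v_1, …, v_μ are σ-invariant, are algebraically independent over K, and generate the fixed algebra P_n^σ as a K-algebra; that is, P_n^σ = K[u_1, …, u_m, v_1, …, v_μ] is a polynomial ring in n−1 variables. -/

import Mathlib

noncomputable section

variable (K : Type*) [Field K] [CharZero K]

/-- `xv K n k` is the variable `x_k` (1-based indexing) in `K[x_1,…,x_n]`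
(junk value `0` when out of range). -/
def xv (n k : ℕ) : MvPolynomial (Fin n) K :=
  if h : k - 1 < n then MvPolynomial.X ⟨k - 1, h⟩ else 0

/-- The binomial coefficient `C(a,b)` for integers, with the convention that
`C(a,b) = 0` unless `0 ≤ b ≤ a`. -/
def ch (a b : ℤ) : ℤ := if 0 ≤ b ∧ b ≤ a then (a.toNat.choose b.toNat : ℤ) else 0

/-- `λ^k_{i,j} = (−1)^{k−i}(C(k−i, j−k) + C(k−i−1, j−k−1))`. -/
def lam (k i j : ℕ) : ℤ :=
  (-1) ^ (k - i) * (ch ((k : ℤ) - i) ((j : ℤ) - k) + ch ((k : ℤ) - i - 1) ((j : ℤ) - k - 1))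

/-- `μ^k_i = (−1)^{k−1}(C(k, i−k) + C(k−1, i−k−1))`. -/
def mu (k i : ℕ) : ℤ :=
  (-1) ^ (k - 1) * (ch (k : ℤ) ((i : ℤ) - k) + ch ((k : ℤ) - 1) ((i : ℤ) - k - 1))

/-- `α^k_{i,j} = (−1)^{k−i}(2C(k−i−1, j−k−1) + 3C(k−i−1, j−k−2)
  + (k−i−1)(C(k−i, j−k−1) + C(k−i−1, j−k−2)))`. -/
def alph (k i j : ℕ) : ℤ :=
  (-1) ^ (k - i) *
    (2 * ch ((k : ℤ) - i - 1) ((j : ℤ) - k - 1) + 3 * ch ((k : ℤ) - i - 1) ((j : ℤ) - k - 2)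
      + ((k : ℤ) - i - 1) *
        (ch ((k : ℤ) - i) ((j : ℤ) - k - 1) + ch ((k : ℤ) - i - 1) ((j : ℤ) - k - 2)))

/-- `β^k_j = α^k_{1,j−1} + α^k_{1,j} + μ^k_{j−1}`. -/
def bet (k j : ℕ) : ℤ := alph k 1 (j - 1) + alph k 1 j + mu k (j - 1)

/-- `u_k = x_k² + Σ_{i=1}^{k−1} Σ_{j=k}^{2k−i} λ^k_{i,j} x_i x_j + Σ_{i=k}^{2k} μ^k_i x_i`. -/
def u (n k : ℕ) : MvPolynomial (Fin n) K :=
  xv K n k ^ 2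
    + ∑ i ∈ Finset.Icc 1 (k - 1), ∑ j ∈ Finset.Icc k (2 * k - i),
        lam k i j • (xv K n i * xv K n j)
    + ∑ i ∈ Finset.Icc k (2 * k), mu k i • xv K n i

/-- For `k ≥ 2`:
`v_k = x_1·u_k + x_k x_{k+1} + Σ_{i=1}^{k−1} Σ_{j=k+1}^{2k−i+1} α^k_{i,j} x_i x_j
  + Σ_{i=k+1}^{2k+1} β^k_i x_i`. -/
def v (n k : ℕ) : MvPolynomial (Fin n) K :=
  xv K n 1 * u K n k + xv K n k * xv K n (k + 1)
    + ∑ i ∈ Finset.Icc 1 (k - 1), ∑ j ∈ Finset.Icc (k + 1) (2 * k - i + 1),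
        alph k i j • (xv K n i * xv K n j)
    + ∑ i ∈ Finset.Icc (k + 1) (2 * k + 1), bet k i • xv K n i

/-- `v_1 = x_1³ + 3x_1x_2 − x_1 + 3x_3`. -/
def v1 (n : ℕ) : MvPolynomial (Fin n) K :=
  xv K n 1 ^ 3 + 3 * xv K n 1 * xv K n 2 - xv K n 1 + 3 * xv K n 3

/-- The family `v_k`, `k ≥ 1`. -/
def vv (n k : ℕ) : MvPolynomial (Fin n) K := if k = 1 then v1 K n else v K n k

section ShiftSum

variable {R : Type*} [CommRing R]

/-- The binomial sum `∑ t, C(r,t) y_{k+t}`, that is, `(1 + U)^r y` at `k`, where `U` is the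
shift `k ↦ k + 1`. -/
def shiftSum (y : ℕ → R) : ℕ → ℕ → R
  | 0, k => y k
  | r + 1, k => shiftSum y r k + shiftSum y r (k + 1)

lemma ch_succ (r : ℕ) (m : ℤ) : ch ((r : ℤ) + 1) m = ch r m + ch r (m - 1) := by
  unfold ch
  rcases lt_trichotomy m 0 with h | h | h
  · rw [if_neg (by omega), if_neg (by omega), if_neg (by omega), add_zero]
  · subst h
    rw [if_pos (by omega), if_pos (by omega), if_neg (by omega)]
    simp
  · obtain ⟨s, rfl⟩ : ∃ s : ℕ, m = s + 1 := ⟨(m - 1).toNat, by omega⟩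
    have h1 : ((r : ℤ) + 1).toNat = r + 1 := by omega
    have h2 : ((s : ℤ) + 1).toNat = s + 1 := by omega
    rw [h1, h2, add_sub_cancel_right, Int.toNat_natCast, Int.toNat_natCast, Nat.choose_succ_succ]
    by_cases h3 : s + 1 ≤ r
    · rw [if_pos (by omega), if_pos (by omega), if_pos (by omega)]
      push_cast
      ring
    · rw [Nat.choose_eq_zero_of_lt (by omega : r < s + 1)]
      by_cases h4 : s ≤ r
      · rw [if_pos (by omega), if_neg (by omega), if_pos (by omega)]
        push_cast
        ring
      · rw [if_neg (by omega), if_neg (by omega), if_neg (by omega), add_zero]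

lemma sum_ch_mul (y : ℕ → R) (r k : ℕ) (S : Finset ℕ) (hS : Finset.Icc k (k + r) ⊆ S)
    (a b : ℤ) (f : ℕ → ℤ) (ha : a = r) (hb : b = k) (hf : ∀ j ∈ S, f j = (j : ℤ) - b) :
    ∑ j ∈ S, (ch a (f j) : R) * y j = shiftSum y r k := by
  rw [ha]
  have hf' : ∀ j ∈ S, (ch r (f j) : R) * y j = (ch r ((j : ℤ) - k) : R) * y j :=
    fun j hj => by rw [hf j hj, hb]
  rw [Finset.sum_congr rfl hf']
  clear hf' hf hb ha
  induction r generalizing k with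
  | zero =>
    rw [Finset.sum_eq_single k]
    · simp [ch, shiftSum]
    · intro j _ hjk
      rw [ch, if_neg (by push_cast; omega)]
      simp
    · intro h
      exact absurd (hS (by simp)) h
  | succ r ih =>
    rw [shiftSum, ← ih k fun j hj => hS (by rw [Finset.mem_Icc] at *; omega),
      ← ih (k + 1) fun j hj => hS (by rw [Finset.mem_Icc] at *; omega), ← Finset.sum_add_distrib]
    refine Finset.sum_congr rfl fun j _ => ?_
    rw [Nat.cast_succ, ch_succ, Nat.cast_succ, sub_sub]
    push_cast
    ring

lemma map_shiftSum (s : R →+* R) (y : ℕ → R) (N : ℕ)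
    (hs : ∀ i < N, s (y (i + 1)) = y (i + 1) + y i) (r k : ℕ) (h : k + r < N) :
    s (shiftSum y r (k + 1)) = shiftSum y r (k + 1) + shiftSum y r k := by
  induction r generalizing k with
  | zero => exact hs k h
  | succ r ih =>
    rw [shiftSum, shiftSum, map_add, ih k (by omega), ih (k + 1) (by omega)]
    ring

/-- The quadratic expression whose value at the variables, with `y 0 = 0`, `y 1 = -1` and
`y (i + 1) = x_i`, is `u_k`. -/
def quadInv (y : ℕ → R) (k : ℕ) : R :=
  y (k + 1) ^ 2 + ∑ r ∈ Finset.range k,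
    (-1) ^ (r + 1) * y (k - r) * (shiftSum y r (k + 1) + 2 * shiftSum y r (k + 2))

/-- A quadratic expression whose difference under the shift automorphism is `quadInv y k`. -/
def quadPrimitive (y : ℕ → R) (k : ℕ) : R :=
  y (k + 1) * y (k + 2) + ∑ r ∈ Finset.range k, (-1) ^ (r + 1) * y (k - r) *
    ((r + 1) * (shiftSum y r (k + 2) + 2 * shiftSum y r (k + 3)) + shiftSum y (r + 1) (k + 2))

lemma map_quadInv (s : R →+* R) (y : ℕ → R) (k : ℕ) (h0 : y 0 = 0)
    (hs : ∀ i < 2 * k + 1, s (y (i + 1)) = y (i + 1) + y i) :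
    s (quadInv y k) = quadInv y k := by
  have key : ∀ m ≤ k, s (∑ r ∈ Finset.range m,
      (-1) ^ (r + 1) * y (k - r) * (shiftSum y r (k + 1) + 2 * shiftSum y r (k + 2))) =
      ∑ r ∈ Finset.range m,
        (-1) ^ (r + 1) * y (k - r) * (shiftSum y r (k + 1) + 2 * shiftSum y r (k + 2))
      - y k * (y k + 2 * y (k + 1))
      + (-1) ^ m * y (k - m) * (shiftSum y m k + 2 * shiftSum y m (k + 1)) := by
    intro m
    induction m with
    | zero =>
      intro _
      simp only [Finset.range_zero, Finset.sum_empty, map_zero, shiftSum, Nat.sub_zero]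
      ring
    | succ m ih =>
      intro hm
      obtain ⟨d, hd⟩ : ∃ d, k - m = d + 1 := ⟨k - m - 1, by omega⟩
      have hd' : k - (m + 1) = d := by omega
      rw [Finset.sum_range_succ, map_add, ih (by omega), hd, hd']
      simp only [map_mul, map_add, map_pow, map_neg, map_one, map_ofNat]
      rw [hs d (by omega), map_shiftSum s y _ hs m k (by omega),
        map_shiftSum s y _ hs m (k + 1) (by omega), shiftSum, shiftSum]
      ring
  unfold quadInv
  rw [map_add, key k le_rfl, map_pow, hs k (by omega), Nat.sub_self, h0]
  ring

lemma map_quadPrimitive (s : R →+* R) (y : ℕ → R) (k : ℕ) (h0 : y 0 = 0)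
    (hs : ∀ i < 2 * k + 2, s (y (i + 1)) = y (i + 1) + y i) :
    s (quadPrimitive y k) = quadPrimitive y k + quadInv y k := by
  have key : ∀ m ≤ k, s (∑ r ∈ Finset.range m, (-1) ^ (r + 1) * y (k - r) *
      ((r + 1) * (shiftSum y r (k + 2) + 2 * shiftSum y r (k + 3))
        + shiftSum y (r + 1) (k + 2))) =
      ∑ r ∈ Finset.range m, (-1) ^ (r + 1) * y (k - r) *
        ((r + 1) * (shiftSum y r (k + 2) + 2 * shiftSum y r (k + 3))
          + shiftSum y (r + 1) (k + 2))
      + ∑ r ∈ Finset.range m,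
        (-1) ^ (r + 1) * y (k - r) * (shiftSum y r (k + 1) + 2 * shiftSum y r (k + 2))
      - y k * (y (k + 1) + y (k + 2))
      + (-1) ^ m * y (k - m) * (m * (shiftSum y m (k + 1) + 2 * shiftSum y m (k + 2))
        + shiftSum y (m + 1) (k + 1)) := by
    intro m
    induction m with
    | zero =>
      intro _
      simp only [Finset.range_zero, Finset.sum_empty, map_zero, shiftSum, Nat.sub_zero]
      push_cast
      ring
    | succ m ih =>
      intro hm
      obtain ⟨d, hd⟩ : ∃ d, k - m = d + 1 := ⟨k - m - 1, by omega⟩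
      have hd' : k - (m + 1) = d := by omega
      rw [Finset.sum_range_succ, map_add, ih (by omega), Finset.sum_range_succ, hd, hd']
      simp only [map_mul, map_add, map_pow, map_neg, map_one, map_ofNat, map_natCast]
      rw [hs d (by omega), map_shiftSum s y _ hs m (k + 1) (by omega),
        map_shiftSum s y _ hs m (k + 2) (by omega),
        map_shiftSum s y _ hs (m + 1) (k + 1) (by omega)]
      simp only [shiftSum]
      push_cast
      ring
  unfold quadPrimitive quadInv
  rw [map_add, key k le_rfl, map_mul, hs k (by omega), hs (k + 1) (by omega), Nat.sub_self, h0]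
  ring

end ShiftSum

section Coefficients

variable {R : Type*} [CommRing R]

lemma shiftSum_comp_succ (y : ℕ → R) (r k : ℕ) :
    shiftSum (fun j => y (j + 1)) r k = shiftSum y r (k + 1) := by
  induction r generalizing k with
  | zero => rfl
  | succ r ih => rw [shiftSum, shiftSum, ih, ih]

lemma sum_ch_mul_succ (y : ℕ → R) (r k : ℕ) (S : Finset ℕ) (hS : Finset.Icc k (k + r) ⊆ S)
    (a b : ℤ) (f : ℕ → ℤ) (ha : a = r) (hb : b = k) (hf : ∀ j ∈ S, f j = (j : ℤ) - b) :
    ∑ j ∈ S, (ch a (f j) : R) * y (j + 1) = shiftSum y r (k + 1) := by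
  rw [← shiftSum_comp_succ]
  exact sum_ch_mul (fun j => y (j + 1)) r k S hS a b f ha hb hf

lemma sum_lam_mul (y : ℕ → R) (i r : ℕ) :
    ∑ j ∈ Finset.Icc (i + r + 1) (2 * (i + r + 1) - i), (lam (i + r + 1) i j : R) * y (j + 1) =
      (-1) ^ (r + 1) * (shiftSum y r (i + r + 2) + 2 * shiftSum y r (i + r + 3)) := by
  have h1 := sum_ch_mul_succ y (r + 1) (i + r + 1)
    (Finset.Icc (i + r + 1) (2 * (i + r + 1) - i))
    (fun j hj => by rw [Finset.mem_Icc] at *; omega) (((i + r + 1 : ℕ) : ℤ) - i)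
    (i + r + 1 : ℕ) (fun j => (j : ℤ) - (i + r + 1 : ℕ)) (by push_cast; ring) rfl
    (fun j _ => rfl)
  have h2 := sum_ch_mul_succ y r (i + r + 2)
    (Finset.Icc (i + r + 1) (2 * (i + r + 1) - i))
    (fun j hj => by rw [Finset.mem_Icc] at *; omega) (((i + r + 1 : ℕ) : ℤ) - i - 1)
    (i + r + 2 : ℕ) (fun j => (j : ℤ) - (i + r + 1 : ℕ) - 1) (by push_cast; ring) rfl
    (fun j _ => by push_cast; ring)
  have h3 : i + r + 1 - i = r + 1 := by omega
  simp only [lam, h3]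
  push_cast at h1 h2 ⊢
  simp only [mul_assoc, add_mul, ← Finset.mul_sum, Finset.sum_add_distrib]
  rw [h1, h2, shiftSum]
  ring

lemma mu_eq_neg_lam (k j : ℕ) : mu (k + 1) j = -lam (k + 1) 0 j := by
  simp only [mu, lam, Nat.add_sub_cancel, Nat.sub_zero, Nat.cast_zero, sub_zero]
  ring

lemma sum_alph_mul (y : ℕ → R) (i r : ℕ) :
    ∑ j ∈ Finset.Icc (i + r + 1 + 1) (2 * (i + r + 1) - i + 1),
        (alph (i + r + 1) i j : R) * y (j + 1) =
      (-1) ^ (r + 1) * ((r + 1) * (shiftSum y r (i + r + 3) + 2 * shiftSum y r (i + r + 4))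
        + shiftSum y (r + 1) (i + r + 3)) := by
  have h1 := sum_ch_mul_succ y r (i + r + 2)
    (Finset.Icc (i + r + 1 + 1) (2 * (i + r + 1) - i + 1))
    (fun j hj => by rw [Finset.mem_Icc] at *; omega) (((i + r + 1 : ℕ) : ℤ) - i - 1)
    (i + r + 2 : ℕ) (fun j => (j : ℤ) - (i + r + 1 : ℕ) - 1) (by push_cast; ring) rfl
    (fun j _ => by push_cast; ring)
  have h2 := sum_ch_mul_succ y r (i + r + 3)
    (Finset.Icc (i + r + 1 + 1) (2 * (i + r + 1) - i + 1))
    (fun j hj => by rw [Finset.mem_Icc] at *; omega) (((i + r + 1 : ℕ) : ℤ) - i - 1)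
    (i + r + 3 : ℕ) (fun j => (j : ℤ) - (i + r + 1 : ℕ) - 2) (by push_cast; ring) rfl
    (fun j _ => by push_cast; ring)
  have h3 := sum_ch_mul_succ y (r + 1) (i + r + 2)
    (Finset.Icc (i + r + 1 + 1) (2 * (i + r + 1) - i + 1))
    (fun j hj => by rw [Finset.mem_Icc] at *; omega) (((i + r + 1 : ℕ) : ℤ) - i)
    (i + r + 2 : ℕ) (fun j => (j : ℤ) - (i + r + 1 : ℕ) - 1) (by push_cast; ring) rfl
    (fun j _ => by push_cast; ring)
  have h4 : i + r + 1 - i = r + 1 := by omega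
  simp only [alph, h4]
  push_cast at h1 h2 h3 ⊢
  simp only [mul_assoc, add_mul, ← Finset.mul_sum, Finset.sum_add_distrib]
  rw [h1, h2, h3, shiftSum]
  ring

lemma bet_eq_neg_alph (k j : ℕ) (hj : k + 2 < j) : bet (k + 2) j = -alph (k + 2) 0 j := by
  obtain ⟨t, rfl⟩ : ∃ t, j = t + 1 := ⟨j - 1, by omega⟩
  have e1 : k + 2 - 1 = k + 1 := by omega
  simp only [bet, alph, mu, Nat.add_sub_cancel, Nat.sub_zero, Nat.cast_zero, sub_zero, e1]
  have a1 : ((k + 2 : ℕ) : ℤ) - (1 : ℕ) - 1 = (k : ℤ) := by push_cast; ring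
  have a2 : ((k + 2 : ℕ) : ℤ) - (1 : ℕ) = (k : ℤ) + 1 := by push_cast; ring
  have a3 : ((k + 2 : ℕ) : ℤ) - 1 = (k : ℤ) + 1 := by push_cast; ring
  have a4 : ((k + 2 : ℕ) : ℤ) = (k : ℤ) + 1 + 1 := by push_cast; ring
  have a5 : ((k + 1 : ℕ) : ℤ) = (k : ℤ) + 1 := by push_cast; ring
  rw [a1, a2, a3, a4]
  have hc : ((t + 1 : ℕ) : ℤ) = t + 1 := by push_cast; ring
  have p := fun m => ch_succ k m
  have q := fun m => ch_succ (k + 1) m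
  simp only [a5, p] at q
  simp only [hc, p, q]
  have b1 : (t : ℤ) + 1 - (k + 1 + 1) - 1 = t - (k + 1 + 1) := by ring
  have b2 : (t : ℤ) + 1 - (k + 1 + 1) - 2 = t - (k + 1 + 1) - 1 := by ring
  have b3 : (t : ℤ) - (k + 1 + 1) - 2 = t - (k + 1 + 1) - 1 - 1 := by ring
  simp only [b1, b2, b3]
  ring

lemma sum_Icc_one_eq_sum_range {M : Type*} [AddCommMonoid M] (m : ℕ) (f : ℕ → M) :
    ∑ i ∈ Finset.Icc 1 m, f i = ∑ r ∈ Finset.range m, f (m - r) := by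
  refine Finset.sum_nbij' (fun i => m - i) (fun r => m - r) ?_ ?_ ?_ ?_ ?_
  · intro i hi
    simp only [Finset.mem_Icc, Finset.mem_range] at *
    omega
  · intro i hi
    simp only [Finset.mem_Icc, Finset.mem_range] at *
    omega
  · intro i hi
    simp only [Finset.mem_Icc] at *
    omega
  · intro i hi
    simp only [Finset.mem_range] at *
    omega
  · intro i hi
    simp only [Finset.mem_Icc] at hi
    rw [Nat.sub_sub_self hi.2]

end Coefficients

section Invariants

variable {K : Type*} [Field K] {n : ℕ}

/-- The sequence `0, -1, x_1, x_2, …`, on which `σ` acts as the identity plus the backward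
shift. -/
def extVar (K : Type*) [Field K] (n : ℕ) : ℕ → MvPolynomial (Fin n) K
  | 0 => 0
  | 1 => -1
  | i + 2 => xv K n (i + 1)

lemma extVar_succ (i : ℕ) (hi : 1 ≤ i) : extVar K n (i + 1) = xv K n i := by
  obtain ⟨t, rfl⟩ : ∃ t, i = t + 1 := ⟨i - 1, by omega⟩
  rfl

lemma map_extVar {σ : MvPolynomial (Fin n) K →+* MvPolynomial (Fin n) K}
    (hσ1 : σ (xv K n 1) = xv K n 1 - 1)
    (hσ : ∀ k, 2 ≤ k → k ≤ n → σ (xv K n k) = xv K n k + xv K n (k - 1))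
    (i : ℕ) (hi : i < n + 1) :
    σ (extVar K n (i + 1)) = extVar K n (i + 1) + extVar K n i := by
  match i with
  | 0 => simp [extVar]
  | 1 => simpa [extVar, sub_eq_add_neg] using hσ1
  | j + 2 => exact hσ (j + 2) (by omega) (by omega)

lemma u_eq_quadInv (k : ℕ) (hk : 1 ≤ k) : u K n k = quadInv (extVar K n) k := by
  obtain ⟨m, rfl⟩ : ∃ m, k = m + 1 := ⟨k - 1, by omega⟩
  rw [u, quadInv, Finset.sum_range_succ, Nat.add_sub_cancel, sum_Icc_one_eq_sum_range,
    extVar_succ (m + 1) hk, add_assoc]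
  congr 2
  · refine Finset.sum_congr rfl fun r hr => ?_
    rw [Finset.mem_range] at hr
    obtain ⟨i, rfl⟩ : ∃ i, m = i + 1 + r := ⟨m - 1 - r, by omega⟩
    have e1 : i + 1 + r - r = i + 1 := by omega
    have e2 : i + 1 + r + 1 - r = i + 2 := by omega
    have h := sum_lam_mul (extVar K n) (i + 1) r
    rw [e1, e2, mul_comm ((-1 : MvPolynomial (Fin n) K) ^ (r + 1)), mul_assoc, ← h,
      Finset.mul_sum]
    refine Finset.sum_congr rfl fun j hj => ?_
    rw [Finset.mem_Icc] at hj
    rw [extVar_succ j (by omega), extVar_succ (i + 1) (by omega), zsmul_eq_mul]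
    ring
  · have e1 : m + 1 - m = 1 := by omega
    have h := sum_lam_mul (extVar K n) 0 m
    simp only [Nat.zero_add, Nat.sub_zero] at h
    rw [e1, mul_comm ((-1 : MvPolynomial (Fin n) K) ^ (m + 1)), mul_assoc, ← h,
      Finset.mul_sum]
    refine Finset.sum_congr rfl fun j hj => ?_
    rw [Finset.mem_Icc] at hj
    rw [extVar_succ j (by omega), mu_eq_neg_lam, zsmul_eq_mul, extVar]
    push_cast
    ring

lemma v_eq_quadPrimitive (k : ℕ) (hk : 2 ≤ k) :
    v K n k = xv K n 1 * u K n k + quadPrimitive (extVar K n) k := by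
  obtain ⟨m, rfl⟩ : ∃ m, k = m + 1 := ⟨k - 1, by omega⟩
  rw [v, quadPrimitive, Finset.sum_range_succ, Nat.add_sub_cancel, sum_Icc_one_eq_sum_range,
    extVar_succ (m + 1) (by omega), extVar_succ (m + 1 + 1) (by omega), add_assoc, add_assoc]
  congr 3
  · refine Finset.sum_congr rfl fun r hr => ?_
    rw [Finset.mem_range] at hr
    obtain ⟨i, rfl⟩ : ∃ i, m = i + 1 + r := ⟨m - 1 - r, by omega⟩
    have e1 : i + 1 + r - r = i + 1 := by omega
    have e2 : i + 1 + r + 1 - r = i + 2 := by omega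
    have h := sum_alph_mul (extVar K n) (i + 1) r
    rw [e1, e2, mul_comm ((-1 : MvPolynomial (Fin n) K) ^ (r + 1)), mul_assoc, ← h,
      Finset.mul_sum]
    refine Finset.sum_congr rfl fun j hj => ?_
    rw [Finset.mem_Icc] at hj
    rw [extVar_succ j (by omega), extVar_succ (i + 1) (by omega), zsmul_eq_mul]
    ring
  · have e1 : m + 1 - m = 1 := by omega
    have h := sum_alph_mul (extVar K n) 0 m
    simp only [Nat.zero_add, Nat.sub_zero] at h
    rw [e1, mul_comm ((-1 : MvPolynomial (Fin n) K) ^ (m + 1)), mul_assoc, ← h,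
      Finset.mul_sum]
    refine Finset.sum_congr rfl fun j hj => ?_
    rw [Finset.mem_Icc] at hj
    obtain ⟨l, rfl⟩ : ∃ l, m = l + 1 := ⟨m - 1, by omega⟩
    rw [extVar_succ j (by omega), bet_eq_neg_alph l j (by omega), zsmul_eq_mul, extVar]
    push_cast
    ring

lemma map_u {σ : MvPolynomial (Fin n) K →+* MvPolynomial (Fin n) K}
    (hσ1 : σ (xv K n 1) = xv K n 1 - 1)
    (hσ : ∀ k, 2 ≤ k → k ≤ n → σ (xv K n k) = xv K n k + xv K n (k - 1))
    (k : ℕ) (hk : 1 ≤ k) (hkn : k ≤ n / 2) : σ (u K n k) = u K n k := by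
  rw [u_eq_quadInv k hk]
  exact map_quadInv σ _ k rfl fun i hi => map_extVar hσ1 hσ i (by omega)

lemma map_vv {σ : MvPolynomial (Fin n) K →+* MvPolynomial (Fin n) K}
    (hσ1 : σ (xv K n 1) = xv K n 1 - 1)
    (hσ : ∀ k, 2 ≤ k → k ≤ n → σ (xv K n k) = xv K n k + xv K n (k - 1))
    (k : ℕ) (hk : 1 ≤ k) (hkn : k ≤ (n - 1) / 2) : σ (vv K n k) = vv K n k := by
  unfold vv
  split_ifs with h
  · simp only [v1, map_add, map_sub, map_mul, map_pow, map_ofNat, hσ1,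
      hσ 2 le_rfl (by omega), hσ 3 (by omega) (by omega), Nat.add_one_sub_one]
    ring
  · rw [v_eq_quadPrimitive k (by omega), map_add, map_mul, hσ1,
      map_u hσ1 hσ k hk (by omega),
      map_quadPrimitive σ _ k rfl fun i hi => map_extVar hσ1 hσ i (by omega),
      ← u_eq_quadInv k hk]
    ring

end Invariants

section Triangular

variable {K : Type*} [Field K] {n : ℕ}

lemma xv_succ (j : Fin n) : xv K n (j + 1) = MvPolynomial.X j := by
  simp [xv]

lemma mem_of_add_zsmul_mem [CharZero K] {A : Subalgebra K (MvPolynomial (Fin n) K)}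
    {p q : MvPolynomial (Fin n) K} {c : ℤ} (hc : c ≠ 0) (hp : p ∈ A) (h : p + c • q ∈ A) :
    q ∈ A := by
  have h1 : c • q ∈ A := by simpa using A.sub_mem h hp
  have hc' : (c : K) ≠ 0 := Int.cast_ne_zero.mpr hc
  have h2 := A.smul_mem h1 ((c : K)⁻¹)
  rwa [← Int.cast_smul_eq_zsmul K, smul_smul, inv_mul_cancel₀ hc', one_smul] at h2

lemma mu_two_mul_ne_zero (k : ℕ) (hk : 1 ≤ k) : mu k (2 * k) ≠ 0 := by
  obtain ⟨m, rfl⟩ : ∃ m, k = m + 1 := ⟨k - 1, by omega⟩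
  have e1 : ((2 * (m + 1) : ℕ) : ℤ) - (m + 1 : ℕ) = (m + 1 : ℕ) := by push_cast; ring
  have e2 : ((m + 1 : ℕ) : ℤ) - 1 = (m : ℕ) := by push_cast; ring
  have c : ∀ a : ℕ, ch a a = 1 := fun a => by simp [ch]
  rw [mu, e1, e2, c, c]
  simp

lemma bet_two_mul_add_one_ne_zero (k : ℕ) (hk : 2 ≤ k) : bet k (2 * k + 1) ≠ 0 := by
  obtain ⟨m, rfl⟩ : ∃ m, k = m + 2 := ⟨k - 2, by omega⟩
  rw [bet_eq_neg_alph m _ (by omega), alph]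
  have e1 : ((m + 2 : ℕ) : ℤ) - (0 : ℕ) - 1 = (m + 1 : ℕ) := by push_cast; ring
  have e2 : ((2 * (m + 2) + 1 : ℕ) : ℤ) - (m + 2 : ℕ) - 1 = (m + 2 : ℕ) := by push_cast; ring
  have e3 : ((2 * (m + 2) + 1 : ℕ) : ℤ) - (m + 2 : ℕ) - 2 = (m + 1 : ℕ) := by push_cast; ring
  have e4 : ((m + 2 : ℕ) : ℤ) - (0 : ℕ) = (m + 2 : ℕ) := by push_cast; ring
  have c1 : ch (m + 1 : ℕ) (m + 2 : ℕ) = 0 := by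
    rw [ch, if_neg (by push_cast; omega)]
  have c2 : ∀ a : ℕ, ch a a = 1 := fun a => by simp [ch]
  rw [e1, e2, e3, e4, c1, c2, c2]
  simp only [ne_eq, neg_eq_zero, mul_eq_zero, pow_eq_zero_iff', not_or]
  constructor
  · simp
  · push_cast
    omega

lemma u_mem {A : Subalgebra K (MvPolynomial (Fin n) K)} {k : ℕ} (hk : 1 ≤ k)
    (h : ∀ i, 1 ≤ i → i ≤ 2 * k → xv K n i ∈ A) : u K n k ∈ A := by
  unfold u
  refine A.add_mem (A.add_mem (A.pow_mem (h _ hk (by omega)) 2) ?_) ?_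
  · refine A.sum_mem fun i hi => A.sum_mem fun j hj => zsmul_mem (A.mul_mem ?_ ?_) _
    all_goals
      rw [Finset.mem_Icc] at *
      exact h _ (by omega) (by omega)
  · refine A.sum_mem fun i hi => zsmul_mem ?_ _
    rw [Finset.mem_Icc] at hi
    exact h _ (by omega) (by omega)

lemma xv_two_mul_mem [CharZero K] {A : Subalgebra K (MvPolynomial (Fin n) K)} {k : ℕ}
    (hk : 1 ≤ k) (h : ∀ i, 1 ≤ i → i < 2 * k → xv K n i ∈ A) (hu : u K n k ∈ A) :
    xv K n (2 * k) ∈ A := by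
  obtain ⟨t, ht⟩ : ∃ t, 2 * k = t + 1 := ⟨2 * k - 1, by omega⟩
  have hmu := mu_two_mul_ne_zero k hk
  unfold u at hu
  rw [ht] at hmu hu ⊢
  rw [Finset.sum_Icc_succ_top (by omega), ← add_assoc] at hu
  refine mem_of_add_zsmul_mem hmu ?_ hu
  refine A.add_mem (A.add_mem (A.pow_mem (h _ hk (by omega)) 2) ?_) ?_
  · refine A.sum_mem fun i hi => A.sum_mem fun j hj => zsmul_mem (A.mul_mem ?_ ?_) _
    all_goals
      rw [Finset.mem_Icc] at *
      exact h _ (by omega) (by omega)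
  · refine A.sum_mem fun i hi => zsmul_mem ?_ _
    rw [Finset.mem_Icc] at hi
    exact h _ (by omega) (by omega)

lemma xv_two_mul_add_one_mem [CharZero K] {A : Subalgebra K (MvPolynomial (Fin n) K)} {k : ℕ}
    (hk : 1 ≤ k) (h : ∀ i, 1 ≤ i → i < 2 * k + 1 → xv K n i ∈ A) (hv : vv K n k ∈ A) :
    xv K n (2 * k + 1) ∈ A := by
  unfold vv at hv
  split_ifs at hv with h1
  · subst h1
    have x1 := h 1 (by omega) (by omega)
    have x2 := h 2 (by omega) (by omega)
    refine mem_of_add_zsmul_mem (c := 3) (by norm_num)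
      (p := xv K n 1 ^ 3 + 3 * xv K n 1 * xv K n 2 - xv K n 1) ?_ (by simpa [v1] using hv)
    exact A.sub_mem (A.add_mem (A.pow_mem x1 3)
      (A.mul_mem (A.mul_mem (ofNat_mem A 3) x1) x2)) x1
  · unfold v at hv
    rw [Finset.sum_Icc_succ_top (by omega), ← add_assoc] at hv
    refine mem_of_add_zsmul_mem (bet_two_mul_add_one_ne_zero k (by omega)) ?_ hv
    refine A.add_mem (A.add_mem (A.add_mem (A.mul_mem (h _ le_rfl (by omega))
      (u_mem hk fun i hi hi' => h i hi (by omega)))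
      (A.mul_mem (h _ hk (by omega)) (h _ (by omega) (by omega)))) ?_) ?_
    · refine A.sum_mem fun i hi => A.sum_mem fun j hj => zsmul_mem (A.mul_mem ?_ ?_) _
      all_goals
        rw [Finset.mem_Icc] at *
        exact h _ (by omega) (by omega)
    · refine A.sum_mem fun i hi => zsmul_mem ?_ _
      rw [Finset.mem_Icc] at hi
      exact h _ (by omega) (by omega)

/-- The coordinate system `x_1, u_1, v_1, u_2, v_2, …` of `K[x_1,…,x_n]`. -/
def invCoord (K : Type*) [Field K] (n : ℕ) (j : Fin n) : MvPolynomial (Fin n) K :=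
  if (j : ℕ) = 0 then MvPolynomial.X j
  else if (j : ℕ) % 2 = 1 then u K n ((j + 1) / 2) else vv K n (j / 2)

lemma invCoord_of_eq_two_mul_add_one {j : Fin n} {k : ℕ} (h : (j : ℕ) = 2 * k + 1) :
    invCoord K n j = u K n (k + 1) := by
  rw [invCoord, if_neg (by omega), if_pos (by omega)]
  congr 1
  omega

lemma invCoord_of_eq_two_mul_add_two {j : Fin n} {k : ℕ} (h : (j : ℕ) = 2 * k + 2) :
    invCoord K n j = vv K n (k + 1) := by
  rw [invCoord, if_neg (by omega), if_neg (by omega)]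
  congr 1
  omega

lemma aeval_invCoord_surjective [CharZero K] :
    Function.Surjective (MvPolynomial.aeval (R := K) (invCoord K n)) := by
  set φ := MvPolynomial.aeval (R := K) (invCoord K n) with hφ
  have hg : ∀ j, invCoord K n j ∈ φ.range := fun j => ⟨MvPolynomial.X j, by simp [hφ]⟩
  have hx : ∀ i, 1 ≤ i → i ≤ n → xv K n i ∈ φ.range := by
    intro i
    induction i using Nat.strong_induction_on with
    | _ i ih =>
      intro hi hin
      have hj := hg ⟨i - 1, by omega⟩
      simp only [invCoord] at hj
      split_ifs at hj with h0 h1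
      · simpa [xv, show i - 1 < n by omega] using hj
      · obtain ⟨k, rfl⟩ : ∃ k, i = 2 * k := ⟨i / 2, by omega⟩
        rw [show (2 * k - 1 + 1) / 2 = k by omega] at hj
        exact xv_two_mul_mem (by omega) (fun l hl hl' => ih l hl' hl (by omega)) hj
      · obtain ⟨k, rfl⟩ : ∃ k, i = 2 * k + 1 := ⟨i / 2, by omega⟩
        rw [show (2 * k + 1 - 1) / 2 = k by omega] at hj
        exact xv_two_mul_add_one_mem (by omega) (fun l hl hl' => ih l hl' hl (by omega)) hj
  rw [← AlgHom.range_eq_top, eq_top_iff, ← MvPolynomial.adjoin_range_X, Algebra.adjoin_le_iff]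
  rintro _ ⟨j, rfl⟩
  rw [← xv_succ]
  exact hx _ (by omega) (by omega)

lemma IsNoetherianRing.injective_of_surjective_ringHom {R : Type*} [CommRing R]
    [IsNoetherianRing R] (f : R →+* R) (hf : Function.Surjective f) : Function.Injective f := by
  have hmono : Monotone fun k => RingHom.ker (f ^ k) := monotone_nat_of_le_succ fun k x hx => by
    rw [RingHom.mem_ker, RingHom.coe_pow] at *
    rw [Function.iterate_succ_apply', hx, map_zero]
  obtain ⟨k, hk⟩ := monotone_stabilizes_iff_noetherian.mpr ‹IsNoetherianRing R› ⟨_, hmono⟩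
  rw [injective_iff_map_eq_zero]
  intro x hx
  obtain ⟨y, rfl⟩ := hf.iterate k x
  have h1 : y ∈ RingHom.ker (f ^ (k + 1)) := by
    rw [RingHom.mem_ker, RingHom.coe_pow, Function.iterate_succ_apply', hx]
  have h2 : y ∈ RingHom.ker (f ^ k) := (hk (k + 1) k.le_succ).ge h1
  rwa [RingHom.mem_ker, RingHom.coe_pow] at h2

lemma algebraicIndependent_invCoord [CharZero K] : AlgebraicIndependent K (invCoord K n) :=
  IsNoetherianRing.injective_of_surjective_ringHom
    (MvPolynomial.aeval (R := K) (invCoord K n)).toRingHom aeval_invCoord_surjective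

end Triangular

section Translation

lemma Polynomial.eq_C_of_comp_X_sub_one {R : Type*} [CommRing R] [IsDomain R] [CharZero R]
    {p : Polynomial R} (h : p.comp (Polynomial.X - 1) = p) : p = Polynomial.C (p.eval 0) := by
  have hstep : ∀ a : R, p.eval (a - 1) = p.eval a := fun a => by
    conv_rhs => rw [← h]
    simp
  have hnat : ∀ m : ℕ, p.eval (m : R) = p.eval 0 := fun m => by
    induction m with
    | zero => simp
    | succ m ih => rw [← ih, ← hstep, Nat.cast_succ, add_sub_cancel_right]
  refine Polynomial.eq_of_infinite_eval_eq _ _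
    ((Set.infinite_range_of_injective (Nat.cast_injective (R := R))).mono ?_)
  rintro _ ⟨m, rfl⟩
  simpa using hnat m

variable {K : Type*} [Field K] {m : ℕ}

/-- The endomorphism `X_0 ↦ X_0 - 1` of a polynomial ring, fixing the other variables. -/
def translateZero (K : Type*) [Field K] (m : ℕ) :
    MvPolynomial (Fin (m + 1)) K →ₐ[K] MvPolynomial (Fin (m + 1)) K :=
  MvPolynomial.aeval (Fin.cases (MvPolynomial.X 0 - 1) fun j => MvPolynomial.X j.succ)

lemma finSuccEquiv_translateZero (q : MvPolynomial (Fin (m + 1)) K) :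
    MvPolynomial.finSuccEquiv K m (translateZero K m q) =
      (MvPolynomial.finSuccEquiv K m q).comp (Polynomial.X - 1) := by
  have h : ((MvPolynomial.finSuccEquiv K m).toAlgHom.comp (translateZero K m)) =
      ((Polynomial.aeval (R := MvPolynomial (Fin m) K) (Polynomial.X - 1)).restrictScalars K).comp
        (MvPolynomial.finSuccEquiv K m).toAlgHom := by
    refine MvPolynomial.algHom_ext fun j => ?_
    refine Fin.cases ?_ (fun i => ?_) j
    · simp [translateZero, MvPolynomial.finSuccEquiv_X_zero]
    · simp [translateZero, MvPolynomial.finSuccEquiv_X_succ]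
  exact DFunLike.congr_fun h q

lemma finSuccEquiv_rename_succ (r : MvPolynomial (Fin m) K) :
    MvPolynomial.finSuccEquiv K m (MvPolynomial.rename Fin.succ r) = Polynomial.C r := by
  have h : ((MvPolynomial.finSuccEquiv K m).toAlgHom.comp (MvPolynomial.rename Fin.succ)) =
      (Algebra.ofId (MvPolynomial (Fin m) K) _).restrictScalars K := by
    refine MvPolynomial.algHom_ext fun j => ?_
    simp [MvPolynomial.finSuccEquiv_X_succ, Algebra.ofId_apply]
  exact DFunLike.congr_fun h r

lemma exists_rename_succ_of_translateZero_eq [CharZero K] {q : MvPolynomial (Fin (m + 1)) K}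
    (h : translateZero K m q = q) :
    ∃ r : MvPolynomial (Fin m) K, MvPolynomial.rename Fin.succ r = q := by
  have h1 := finSuccEquiv_translateZero q
  rw [h] at h1
  have h2 := Polynomial.eq_C_of_comp_X_sub_one h1.symm
  refine ⟨(MvPolynomial.finSuccEquiv K m q).eval 0,
    (MvPolynomial.finSuccEquiv K m).injective ?_⟩
  rw [finSuccEquiv_rename_succ]
  exact h2.symm

end Translation

/-- The fixed algebra `P_n^σ` is the polynomial algebra `K[u_1,…,u_m,v_1,…,v_μ]`,
where `m = ⌊n/2⌋`, `μ = ⌊(n−1)/2⌋`. -/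
theorem fixed_algebra_eq_adjoin_u_v {K : Type*} [Field K] [CharZero K] {n : ℕ} (hn : 2 ≤ n)
    (σ : MvPolynomial (Fin n) K ≃ₐ[K] MvPolynomial (Fin n) K)
    (hσ1 : σ (xv K n 1) = xv K n 1 - 1)
    (hσ : ∀ k, 2 ≤ k → k ≤ n → σ (xv K n k) = xv K n k + xv K n (k - 1)) :
    (∀ k, 1 ≤ k → k ≤ n / 2 → σ (u K n k) = u K n k)
    ∧ (∀ k, 1 ≤ k → k ≤ (n - 1) / 2 → σ (vv K n k) = vv K n k)
    ∧ AlgebraicIndependent K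
        (Sum.elim (fun a : Fin (n / 2) => u K n ((a : ℕ) + 1))
          (fun b : Fin ((n - 1) / 2) => vv K n ((b : ℕ) + 1)))
    ∧ (∀ pp : MvPolynomial (Fin n) K,
        σ pp = pp ↔
          pp ∈ Algebra.adjoin K
            (Set.range
              (Sum.elim (fun a : Fin (n / 2) => u K n ((a : ℕ) + 1))
                (fun b : Fin ((n - 1) / 2) => vv K n ((b : ℕ) + 1))))) := by
  have hu : ∀ k, 1 ≤ k → k ≤ n / 2 → σ (u K n k) = u K n k :=
    map_u (σ := (σ : MvPolynomial (Fin n) K →+* MvPolynomial (Fin n) K)) hσ1 hσ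
  have hv : ∀ k, 1 ≤ k → k ≤ (n - 1) / 2 → σ (vv K n k) = vv K n k :=
    map_vv (σ := (σ : MvPolynomial (Fin n) K →+* MvPolynomial (Fin n) K)) hσ1 hσ
  refine ⟨hu, hv, ?_, fun pp => ⟨fun hpp => ?_, fun hpp => ?_⟩⟩
  · let e : Fin (n / 2) ⊕ Fin ((n - 1) / 2) → Fin n :=
      Sum.elim (fun a => ⟨2 * a + 1, by omega⟩) (fun b => ⟨2 * b + 2, by omega⟩)
    have he : Function.Injective e := by
      rintro (a | a) (b | b) h <;> simp only [e, Sum.elim_inl, Sum.elim_inr, Fin.mk.injEq] at h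
      · exact congrArg Sum.inl (Fin.ext (by omega))
      · omega
      · omega
      · exact congrArg Sum.inr (Fin.ext (by omega))
    convert (algebraicIndependent_invCoord (K := K) (n := n)).comp e he using 1
    funext s
    rcases s with a | b
    · exact (invCoord_of_eq_two_mul_add_one rfl).symm
    · exact (invCoord_of_eq_two_mul_add_two rfl).symm
  · obtain ⟨m, rfl⟩ : ∃ m, n = m + 1 := ⟨n - 1, by omega⟩
    obtain ⟨q, rfl⟩ := aeval_invCoord_surjective (K := K) pp
    have hcomm : ((σ : MvPolynomial (Fin (m + 1)) K →ₐ[K] MvPolynomial (Fin (m + 1)) K).comp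
        (MvPolynomial.aeval (invCoord K (m + 1)))) =
        (MvPolynomial.aeval (invCoord K (m + 1))).comp (translateZero K m) := by
      refine MvPolynomial.algHom_ext fun j => ?_
      refine Fin.cases ?_ (fun i => ?_) j
      · simpa [translateZero, invCoord, xv] using hσ1
      · simp only [AlgHom.comp_apply, MvPolynomial.aeval_X, translateZero, Fin.cases_succ,
          invCoord, Fin.val_succ]
        rw [if_neg (by omega)]
        split_ifs
        · exact hu _ (by omega) (by omega)
        · exact hv _ (by omega) (by omega)
    have hq : translateZero K m q = q :=
      algebraicIndependent_invCoord ((DFunLike.congr_fun hcomm q).symm.trans hpp)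
    obtain ⟨r, rfl⟩ := exists_rename_succ_of_translateZero_eq hq
    rw [MvPolynomial.aeval_rename]
    have hr : MvPolynomial.aeval (invCoord K (m + 1) ∘ Fin.succ) r ∈
        Algebra.adjoin K (Set.range (invCoord K (m + 1) ∘ Fin.succ)) := by
      rw [Algebra.adjoin_range_eq_range_aeval]
      exact AlgHom.mem_range_self _ r
    refine Algebra.adjoin_mono ?_ hr
    rintro _ ⟨i, rfl⟩
    rcases Nat.even_or_odd' (i : ℕ) with ⟨k, hk | hk⟩
    · refine ⟨Sum.inl ⟨k, by omega⟩, ?_⟩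
      exact (invCoord_of_eq_two_mul_add_one (by rw [Fin.val_succ, hk])).symm
    · refine ⟨Sum.inr ⟨k, by omega⟩, ?_⟩
      exact (invCoord_of_eq_two_mul_add_two (by rw [Fin.val_succ, hk])).symm
  · have hle : Algebra.adjoin K (Set.range
        (Sum.elim (fun a : Fin (n / 2) => u K n ((a : ℕ) + 1))
          (fun b : Fin ((n - 1) / 2) => vv K n ((b : ℕ) + 1)))) ≤
        AlgHom.equalizer (σ : MvPolynomial (Fin n) K →ₐ[K] MvPolynomial (Fin n) K)
          (AlgHom.id K _) := by
      rw [Algebra.adjoin_le_iff]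
      rintro _ ⟨a | b, rfl⟩
      · exact hu _ (by omega) (by omega)
      · exact hv _ (by omega) (by omega)
    exact hle hpp
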